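/- arXiv:2601.22517 — 2 statements merged into one kernel-verified Lean document; each statement's English description precedes it below -/
import Mathlib

section
/- Let Z be a nonempty compact metric space and u : Z × Z → ℝ a continuous function. Then the two-player zero-sum game with mixed strategies given by Borel probability measures on Z and payoff given by the mixed extension of u has a value: sup over probability measures μ on Z of (inf over probability measures ν on Z of ∫∫ u(z₁,z₂) dμ(z₁) dν(z₂)) equals inf over probability measures ν on Z of (sup over probability measures μ on Z of ∫∫ u(z₁,z₂) dμ(z₁) dν(z₂)). -/
open MeasureTheory

/-- The mixed extension of a payoff `u` to probability measures:
`U u μ ν = ∫∫ u(z₁,z₂) dμ(z₁) dν(z₂)`. -/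
noncomputable def mixedPayoff {Z : Type*} [MeasurableSpace Z]
    (u : Z × Z → ℝ) (μ ν : Measure Z) : ℝ :=
  ∫ z₁, ∫ z₂, u (z₁, z₂) ∂ν ∂μ

section PositiveFunctionals

variable {X : Type*} [TopologicalSpace X] [T2Space X] [CompactSpace X]
  [MeasurableSpace X] [BorelSpace X]

/-- A normalized positive linear functional on the continuous functions on a compact Hausdorff
space is integration against a probability measure. -/
theorem exists_probabilityMeasure_integral_eq (Λ : C(X, ℝ) →ₗ[ℝ] ℝ)
    (hΛ : ∀ f, 0 ≤ f → 0 ≤ Λ f) (hΛ_one : Λ 1 = 1) :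
    ∃ μ : ProbabilityMeasure X, ∀ f : C(X, ℝ), ∫ x, f x ∂(μ : Measure X) = Λ f := by
  let Λ' : CompactlySupportedContinuousMap X ℝ →ₚ[ℝ] ℝ := PositiveLinearMap.mk₀
    { toFun := fun f => Λ (f : C(X, ℝ))
      map_add' := fun f g => Λ.map_add (f : C(X, ℝ)) (g : C(X, ℝ))
      map_smul' := fun c f => Λ.map_smul c (f : C(X, ℝ)) }
    (fun f hf => hΛ (f : C(X, ℝ)) fun x => hf x)
  have h (f : C(X, ℝ)) : ∫ x, f x ∂(RealRMK.rieszMeasure Λ') = Λ f :=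
    RealRMK.integral_rieszMeasure Λ' (CompactlySupportedContinuousMap.continuousMapEquiv f)
  refine ⟨⟨RealRMK.rieszMeasure Λ', ⟨?_⟩⟩, h⟩
  have h_one := h 1
  simp only [ContinuousMap.one_apply, integral_const, smul_eq_mul, mul_one, hΛ_one] at h_one
  exact (ENNReal.toReal_eq_one_iff _).1 h_one

/-- If every function in a convex set of continuous functions attains a value at least `c`, then
some probability measure gives all of them an integral at least `c`. -/
theorem exists_probabilityMeasure_forall_le_integral {K : Set C(X, ℝ)} (hK : Convex ℝ K)
    (hK_nonempty : K.Nonempty) {c : ℝ} (hc : ∀ k ∈ K, ∃ x, c ≤ k x) :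
    ∃ μ : ProbabilityMeasure X, ∀ k ∈ K, c ≤ ∫ x, k x ∂(μ : Measure X) := by
  let O : Set C(X, ℝ) := {g | ∀ x, g x < c}
  have hO_convex : Convex ℝ O := fun f hf g hg a b ha hb hab x =>
    convex_Iio c (hf x) (hg x) ha hb hab
  have hO_open : IsOpen O := by
    have h := ContinuousMap.isOpen_setOfPred_mapsTo (isCompact_univ (X := X)) (isOpen_Iio (a := c))
    simpa [O, Set.MapsTo] using h
  have h_disj : Disjoint O K := Set.disjoint_left.2 fun g hg hgK =>
    let ⟨x, hx⟩ := hc g hgK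
    (hg x).not_ge hx
  obtain ⟨L, r, hLO, hLK⟩ := geometric_hahn_banach_open hO_convex hO_open hK h_disj
  have hL_nonneg (f : C(X, ℝ)) (hf : 0 ≤ f) : 0 ≤ L f := by
    have h_ray (t : ℝ) (ht : 0 ≤ t) : (c - 1) * L 1 - t * L f < r := by
      have h := hLO ((c - 1) • 1 - t • f) fun x => by
        have : 0 ≤ t * f x := mul_nonneg ht (hf x)
        simp only [ContinuousMap.sub_apply, ContinuousMap.smul_apply, ContinuousMap.one_apply,
          smul_eq_mul]
        linarith
      simpa using h
    by_contra! hneg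
    have h₀ := h_ray 0 le_rfl
    have h := h_ray ((r - (c - 1) * L 1) / -L f) (div_nonneg (by linarith) (by linarith))
    rw [div_neg, neg_mul, div_mul_cancel₀ _ hneg.ne] at h
    linarith
  have h_const {ε : ℝ} (hε : 0 < ε) : (c - ε) * L 1 < r := by
    have h := hLO ((c - ε) • 1) fun x => by simpa using hε
    simpa using h
  have hL_one : 0 < L 1 := by
    obtain ⟨k, hk⟩ := hK_nonempty
    have h₁ := h_const one_pos
    have h₂ := hLK k hk
    have h₃ := hL_nonneg ((|c| + ‖k‖) • 1 - k) fun x => by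
      have := (le_abs_self _).trans (k.norm_coe_le_norm x)
      have := abs_nonneg c
      change 0 ≤ (|c| + ‖k‖) * 1 - k x
      linarith
    simp only [map_sub, map_smul, smul_eq_mul] at h₃
    have h₄ : 0 < (|c| + ‖k‖ - (c - 1)) * L 1 := by linarith
    have := le_abs_self c
    have := norm_nonneg k
    exact pos_of_mul_pos_right h₄ (by linarith)
  have h_le : c * L 1 ≤ r := by
    refine le_of_forall_pos_lt_add fun δ hδ => ?_
    have h := h_const (div_pos hδ hL_one)
    rw [sub_mul, div_mul_cancel₀ _ hL_one.ne'] at h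
    linarith
  obtain ⟨μ, hμ⟩ := exists_probabilityMeasure_integral_eq ((L 1)⁻¹ • L.toLinearMap)
    (fun f hf => mul_nonneg (inv_nonneg.2 hL_one.le) (hL_nonneg f hf))
    (inv_mul_cancel₀ hL_one.ne')
  refine ⟨μ, fun k hk => ?_⟩
  rw [hμ k]
  refine (le_inv_mul_iff₀ hL_one).2 ?_
  rw [mul_comm]
  exact h_le.trans (hLK k hk)

end PositiveFunctionals

section MixedPayoff

variable {Z : Type*} [MetricSpace Z] [CompactSpace Z] [MeasurableSpace Z] [BorelSpace Z]
  {u : Z × Z → ℝ}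

theorem continuous_integral_right_of_continuous (hu : Continuous u) (ν : Measure Z)
    [IsFiniteMeasure ν] : Continuous fun z₁ => ∫ z₂, u (z₁, z₂) ∂ν := by
  simpa using continuous_parametric_integral_of_continuous (μ := ν)
    (f := fun z₁ z₂ => u (z₁, z₂)) hu isCompact_univ

theorem integrable_of_continuous_of_compactSpace {f : Z → ℝ} (hf : Continuous f) (μ : Measure Z)
    [IsFiniteMeasure μ] : Integrable f μ :=
  hf.integrable_of_hasCompactSupport (HasCompactSupport.of_compactSpace f)

theorem convex_range_integral_right (hu : Continuous u) :
    Convex ℝ (Set.range fun ν : ProbabilityMeasure Z =>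
      (⟨fun z₁ => ∫ z₂, u (z₁, z₂) ∂(ν : Measure Z),
        continuous_integral_right_of_continuous hu ν⟩ : C(Z, ℝ))) := by
  rintro _ ⟨ν, rfl⟩ _ ⟨ν', rfl⟩ a b ha hb hab
  have h_prob : IsProbabilityMeasure
      (ENNReal.ofReal a • (ν : Measure Z) + ENNReal.ofReal b • (ν' : Measure Z)) :=
    ⟨by simp [← ENNReal.ofReal_add ha hb, hab]⟩
  refine ⟨⟨_, h_prob⟩, ContinuousMap.ext fun z₁ => ?_⟩
  have h_int (ρ : ProbabilityMeasure Z) : Integrable (fun z₂ => u (z₁, z₂)) (ρ : Measure Z) :=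
    integrable_of_continuous_of_compactSpace (by fun_prop) _
  simp [integral_add_measure ((h_int ν).smul_measure ENNReal.ofReal_ne_top)
    ((h_int ν').smul_measure ENNReal.ofReal_ne_top), integral_smul_measure, ha, hb]

end MixedPayoff

theorem exists_abs_mixedPayoff_le {Z : Type*} [TopologicalSpace Z] [CompactSpace Z]
    [MeasurableSpace Z] {u : Z × Z → ℝ} (hu : Continuous u) :
    ∃ C, ∀ μ ν : ProbabilityMeasure Z, |mixedPayoff u (μ : Measure Z) (ν : Measure Z)| ≤ C := by
  obtain ⟨C, hC⟩ := isCompact_univ.exists_bound_of_continuousOn hu.continuousOn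
  refine ⟨C, fun μ ν => ?_⟩
  have h_inner (z₁ : Z) : ‖∫ z₂, u (z₁, z₂) ∂(ν : Measure Z)‖ ≤ C := by
    simpa using norm_integral_le_of_norm_le_const (μ := (ν : Measure Z))
      (Filter.Eventually.of_forall fun z₂ => hC (z₁, z₂) trivial)
  simpa [mixedPayoff] using norm_integral_le_of_norm_le_const (μ := (μ : Measure Z))
    (Filter.Eventually.of_forall h_inner)

/-- The two-player zero-sum game on a nonempty compact metric space with continuous
payoff has a value: `sup_μ inf_ν u(μ,ν) = inf_ν sup_μ u(μ,ν)` over Borel probability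
measures. -/
theorem zero_sum_game_has_value
    {Z : Type*} [MetricSpace Z] [CompactSpace Z] [Nonempty Z]
    [MeasurableSpace Z] [BorelSpace Z]
    (u : Z × Z → ℝ) (hu : Continuous u) :
    (⨆ μ : ProbabilityMeasure Z, ⨅ ν : ProbabilityMeasure Z,
        mixedPayoff u (μ : Measure Z) (ν : Measure Z)) =
    (⨅ ν : ProbabilityMeasure Z, ⨆ μ : ProbabilityMeasure Z,
        mixedPayoff u (μ : Measure Z) (ν : Measure Z)) := by
  obtain ⟨C, hC⟩ := exists_abs_mixedPayoff_le hu
  have h_below (μ : ProbabilityMeasure Z) : BddBelow (Set.range fun ν : ProbabilityMeasure Z =>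
      mixedPayoff u (μ : Measure Z) (ν : Measure Z)) :=
    ⟨-C, Set.forall_mem_range.2 fun ν => (abs_le.1 (hC μ ν)).1⟩
  have h_above (ν : ProbabilityMeasure Z) : BddAbove (Set.range fun μ : ProbabilityMeasure Z =>
      mixedPayoff u (μ : Measure Z) (ν : Measure Z)) :=
    ⟨C, Set.forall_mem_range.2 fun μ => (abs_le.1 (hC μ ν)).2⟩
  have z₀ : ProbabilityMeasure Z :=
    ⟨Measure.dirac (Classical.arbitrary Z), Measure.dirac.isProbabilityMeasure⟩
  have : Nonempty (ProbabilityMeasure Z) := ⟨z₀⟩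
  apply le_antisymm
  · exact ciSup_le fun μ => le_ciInf fun ν =>
      (ciInf_le (h_below μ) ν).trans (le_ciSup (h_above ν) μ)
  · set V := ⨅ ν : ProbabilityMeasure Z, ⨆ μ : ProbabilityMeasure Z,
      mixedPayoff u (μ : Measure Z) (ν : Measure Z) with hV
    have hV_le (ν : ProbabilityMeasure Z) : V ≤ ⨆ μ : ProbabilityMeasure Z,
        mixedPayoff u (μ : Measure Z) (ν : Measure Z) := by
      refine ciInf_le ⟨-C, Set.forall_mem_range.2 fun ν => ?_⟩ ν
      exact (abs_le.1 (hC z₀ ν)).1.trans (le_ciSup (h_above ν) z₀)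
    obtain ⟨μ, hμ⟩ := exists_probabilityMeasure_forall_le_integral
      (convex_range_integral_right hu) (Set.range_nonempty _) (c := V) <| by
        rintro _ ⟨ν, rfl⟩
        have h_cont := continuous_integral_right_of_continuous hu (ν : Measure Z)
        obtain ⟨z, -, hz⟩ := isCompact_univ.exists_isMaxOn Set.univ_nonempty h_cont.continuousOn
        refine ⟨z, (hV_le ν).trans (ciSup_le fun μ => ?_)⟩
        simpa [mixedPayoff] using integral_mono
          (integrable_of_continuous_of_compactSpace h_cont (μ : Measure Z))
          (integrable_const _) fun z₁ => hz (Set.mem_univ z₁)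
    refine le_ciSup_of_le ⟨C, Set.forall_mem_range.2 fun μ => ?_⟩ μ
      (le_ciInf fun ν => hμ _ ⟨ν, rfl⟩)
    exact (ciInf_le (h_below μ) z₀).trans (abs_le.1 (hC μ z₀)).2
end

section
/- Let Z be a nonempty compact metric space and u : Z × Z → ℝ a continuous function. Then there exists a mixed-strategy Nash equilibrium, i.e., Borel probability measures μ* and ν* on Z such that u(μ,ν*) ≤ u(μ*,ν*) ≤ u(μ*,ν) for every pair of Borel probability measures μ, ν on Z, where u(μ,ν) denotes the mixed extension ∫∫ u(z₁,z₂) dμ(z₁) dν(z₂). -/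
open MeasureTheory

/-- Integration against a probability measure, as an element of the weak-* dual of the space of
continuous functions on a compact space. -/
noncomputable def integralWeakDual {Z : Type*} [TopologicalSpace Z] [CompactSpace Z]
    [MeasurableSpace Z] [BorelSpace Z] (μ : ProbabilityMeasure Z) : WeakDual ℝ C(Z, ℝ) :=
  StrongDual.toWeakDual <| LinearMap.mkContinuous
    { toFun := fun g ↦ ∫ z, g z ∂(μ : Measure Z)
      map_add' := fun g h ↦ integral_add
        (g.continuous.integrable_of_hasCompactSupport (.of_compactSpace _))
        (h.continuous.integrable_of_hasCompactSupport (.of_compactSpace _))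
      map_smul' := fun c g ↦ integral_const_mul c g } 1 fun g ↦ by
    simpa using norm_integral_le_of_norm_le_const (μ := (μ : Measure Z))
      (Filter.Eventually.of_forall g.norm_coe_le_norm)

theorem continuous_integralWeakDual {Z : Type*} [TopologicalSpace Z] [CompactSpace Z]
    [MeasurableSpace Z] [BorelSpace Z] :
    Continuous (integralWeakDual : ProbabilityMeasure Z → WeakDual ℝ C(Z, ℝ)) :=
  WeakDual.continuous_of_continuous_eval fun g ↦
    ProbabilityMeasure.continuous_integral_boundedContinuousFunction
      (BoundedContinuousFunction.mkOfCompact g)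

theorem convex_range_integralWeakDual {Z : Type*} [TopologicalSpace Z] [CompactSpace Z]
    [MeasurableSpace Z] [BorelSpace Z] :
    Convex ℝ (Set.range (integralWeakDual : ProbabilityMeasure Z → WeakDual ℝ C(Z, ℝ))) := by
  rintro _ ⟨μ, rfl⟩ _ ⟨ν, rfl⟩ a b ha hb hab
  have hprob : IsProbabilityMeasure
      (ENNReal.ofReal a • (μ : Measure Z) + ENNReal.ofReal b • (ν : Measure Z)) := by
    constructor
    simp [← ENNReal.ofReal_add ha hb, hab]
  refine ⟨⟨_, hprob⟩, ContinuousLinearMap.ext fun g ↦ ?_⟩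
  have hg (ρ : ProbabilityMeasure Z) : Integrable g (ρ : Measure Z) :=
    g.continuous.integrable_of_hasCompactSupport (.of_compactSpace _)
  change ∫ z, g z ∂(ENNReal.ofReal a • (μ : Measure Z) + ENNReal.ofReal b • (ν : Measure Z)) =
    a * ∫ z, g z ∂(μ : Measure Z) + b * ∫ z, g z ∂(ν : Measure Z)
  rw [integral_add_measure ((hg μ).smul_measure ENNReal.ofReal_ne_top)
    ((hg ν).smul_measure ENNReal.ofReal_ne_top), integral_smul_measure, integral_smul_measure,
    ENNReal.toReal_ofReal ha, ENNReal.toReal_ofReal hb, smul_eq_mul, smul_eq_mul]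

/-- The expected payoff against a fixed mixed strategy depends jointly continuously on the
strategy and on the opponent's action. -/
theorem continuous_integral_prodMk {Z : Type*} [MetricSpace Z] [CompactSpace Z]
    [MeasurableSpace Z] [BorelSpace Z] {u : Z × Z → ℝ} (hu : Continuous u) :
    Continuous fun p : ProbabilityMeasure Z × Z ↦ ∫ z, u (p.2, z) ∂(p.1 : Measure Z) := by
  have h := (ProbabilityMeasure.continuous_integral_boundedContinuousFunction
    (BoundedContinuousFunction.mkOfCompact ⟨u, hu⟩)).comp
    (ProbabilityMeasure.continuous_prod.comp
      ((continuous_diracProba.comp continuous_snd).prodMk continuous_fst))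
  refine h.congr fun p ↦ ?_
  have hint : Integrable u ((Measure.dirac p.2).prod (p.1 : Measure Z)) :=
    hu.integrable_of_hasCompactSupport (.of_compactSpace _)
  exact (integral_prod _ hint).trans (integral_dirac _ _)

/-- Existence of a mixed-strategy Nash equilibrium for a two-player zero-sum game on a
nonempty compact metric space with continuous payoff: there exist Borel probability
measures `μ*, ν*` such that `u(μ,ν*) ≤ u(μ*,ν*) ≤ u(μ*,ν)` for all `μ, ν`. -/
theorem exists_mixed_nash_equilibrium
    {Z : Type*} [MetricSpace Z] [CompactSpace Z] [Nonempty Z]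
    [MeasurableSpace Z] [BorelSpace Z]
    (u : Z × Z → ℝ) (hu : Continuous u) :
    ∃ μs νs : ProbabilityMeasure Z,
      (∀ μ : ProbabilityMeasure Z,
        mixedPayoff u (μ : Measure Z) (νs : Measure Z) ≤
          mixedPayoff u (μs : Measure Z) (νs : Measure Z)) ∧
      (∀ ν : ProbabilityMeasure Z,
        mixedPayoff u (μs : Measure Z) (νs : Measure Z) ≤
          mixedPayoff u (μs : Measure Z) (ν : Measure Z)) := by
  let φ : C(ProbabilityMeasure Z, C(Z, ℝ)) := ContinuousMap.curry ⟨_, continuous_integral_prodMk hu⟩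
  have : Nonempty (ProbabilityMeasure Z) := Nonempty.map diracProba ‹_›
  have hconv : Convex ℝ (Set.range φ) := by
    rintro _ ⟨μ, rfl⟩ _ ⟨ν, rfl⟩ a b ha hb hab
    obtain ⟨ρ, hρ⟩ := convex_range_integralWeakDual ⟨μ, rfl⟩ ⟨ν, rfl⟩ ha hb hab
    refine ⟨ρ, ContinuousMap.ext fun z ↦ ?_⟩
    exact DFunLike.congr_fun hρ (⟨fun z₂ ↦ u (z, z₂), by fun_prop⟩ : C(Z, ℝ))
  obtain ⟨_, ⟨νs, rfl⟩, _, ⟨μs, rfl⟩, h⟩ := Sion.exists_isSaddlePointOn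
    (X := Set.range φ) (Y := Set.range (integralWeakDual (Z := Z))) (f := fun g Λ ↦ Λ g)
    (Set.range_nonempty _) hconv (isCompact_range φ.continuous)
    (fun Λ _ ↦ (map_continuous Λ).lowerSemicontinuous.lowerSemicontinuousOn _)
    (fun Λ _ ↦ (LinearMap.convexOn (Λ : C(Z, ℝ) →ₗ[ℝ] ℝ) hconv).quasiconvexOn)
    convex_range_integralWeakDual (Set.range_nonempty _)
    (isCompact_range continuous_integralWeakDual)
    (fun g _ ↦ (WeakDual.eval_continuous g).upperSemicontinuous.upperSemicontinuousOn _)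
    (fun g _ ↦ ConcaveOn.quasiconcaveOn
      ⟨convex_range_integralWeakDual, fun _ _ _ _ _ _ _ _ _ ↦ le_rfl⟩)
  exact ⟨μs, νs, fun μ ↦ h _ ⟨νs, rfl⟩ _ ⟨μ, rfl⟩, fun ν ↦ h _ ⟨ν, rfl⟩ _ ⟨μs, rfl⟩⟩
end
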